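/- arXiv:2502.17145 — 2 statements merged into one kernel-verified Lean document; each statement's English description precedes it below -/
import Mathlib

section
/- Let p ≤ q be coprime positive integers. Then the exponential growth rate of the number of exact overlaps is bounded by the topological pressure of φ on the extended line: limsup_{n→∞} (1/n) log N_n ≤ limsup_{n→∞} (1/n) log( ∑_{z ∈ Z_n} exp( sup_{ω ∈ [z]} ∑_{j=0}^{n−1} φ(σ^j ω) ) ), where σ is the left shift on sequences. -/
/-- The four matrices `A_b` indexed by `B = {(0,0),(1,0),(0,1),(1,1)}`
(encoded as `Bool × Bool`, `false ↦ 0`, `true ↦ 1`), with real entries. -/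
def Amat : Bool × Bool → Matrix (Fin 4) (Fin 4) ℝ
  | (false, false) => !![3,1,1,1; 0,1,0,0; 0,0,1,0; 0,0,0,1]
  | (true, false)  => !![1,0,1,0; 1,3,0,1; 0,0,0,0; 0,0,1,1]
  | (false, true)  => !![1,1,0,0; 0,0,0,0; 1,0,3,1; 0,1,0,1]
  | (true, true)   => !![1,0,0,0; 0,1,0,0; 0,0,1,0; 1,1,1,3]

/-- `W(ω_1⋯ω_n) = (1,1,1,1) · A_{ω_1}⋯A_{ω_n} · (1,0,0,0)ᵀ` for the length-`n`
prefix of the sequence `ω`. -/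
def Wpre (ω : ℕ → Bool × Bool) (n : ℕ) : ℝ :=
  ∑ i : Fin 4, ((List.ofFn fun k : Fin n => Amat (ω k)).prod) i 0

/-- The potential `φ(ω) = limsup_n log( W(ω_1⋯ω_n)/W(ω_2⋯ω_n) )`. -/
noncomputable def phi (ω : ℕ → Bool × Bool) : ℝ :=
  Filter.limsup (fun n => Real.log (Wpre ω n / Wpre (fun i => ω (i + 1)) (n - 1)))
    Filter.atTop

/-- `X_θ`: sequences `ω ∈ B^ℕ` whose associated point
`(∑ ω_{i,1} 2^{-i}, ∑ ω_{i,2} 2^{-i})` lies on the extended line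
`l_{p/q} = {(t mod 1, (p/q)·t mod 1) : t ∈ ℝ}`. -/
def Xtheta (p q : ℕ) : Set (ℕ → Bool × Bool) :=
  {ω | ∃ t : ℝ,
    Int.fract t = ∑' i : ℕ, (if (ω i).1 then (1 : ℝ) else 0) / 2 ^ (i + 1) ∧
    Int.fract ((p : ℝ) / (q : ℝ) * t)
      = ∑' i : ℕ, (if (ω i).2 then (1 : ℝ) else 0) / 2 ^ (i + 1)}

/-- `Z_n`: words `z ∈ B^n` with `p·∑ z_{i,1} 2^{n-i} = q·∑ z_{i,2} 2^{n-i}`. -/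
def Zset (p q n : ℕ) : Finset (Fin n → Bool × Bool) :=
  Finset.univ.filter fun z =>
    p * ∑ i : Fin n, (if (z i).1 then 1 else 0) * 2 ^ (n - 1 - (i : ℕ))
      = q * ∑ i : Fin n, (if (z i).2 then 1 else 0) * 2 ^ (n - 1 - (i : ℕ))

/-- The digit set `D = {0, 1, p/q} ⊆ ℚ`. -/
def Dset (p q : ℕ) : Finset ℚ := {0, 1, (p : ℚ) / (q : ℚ)}

/-- Words of length `n` over `D`. -/
def Dwords (p q n : ℕ) : Finset (Fin n → ℚ) :=
  Fintype.piFinset fun _ => Dset p q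

/-- The value `∑_{i=1}^n a_i 2^{-i}` of a word. -/
def valD {n : ℕ} (a : Fin n → ℚ) : ℚ :=
  ∑ i : Fin n, a i / 2 ^ ((i : ℕ) + 1)

/-- `N_n`: the number of exactly-overlapping pairs `(a,b) ∈ D^n × D^n`. -/
def Ncount (p q n : ℕ) : ℕ :=
  (((Dwords p q n) ×ˢ (Dwords p q n)).filter fun ab => valD ab.1 = valD ab.2).card

/-- The base-two value of a word of integer digits, most significant digit first. -/
def digitSum {α : Type*} (f : α → ℤ) {n : ℕ} (w : Fin n → α) : ℤ :=
  ∑ i : Fin n, f (w i) * 2 ^ (n - 1 - (i : ℕ))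

theorem digitSum_succ {α : Type*} (f : α → ℤ) {n : ℕ} (w : Fin (n + 1) → α) :
    digitSum f w = f (w 0) * 2 ^ n + digitSum f (fun i => w i.succ) := by
  unfold digitSum
  rw [Fin.sum_univ_succ]
  congr 1
  refine Finset.sum_congr rfl fun i _ => ?_
  have : n + 1 - 1 - ((i.succ : Fin (n + 1)) : ℕ) = n - 1 - (i : ℕ) := by
    simp only [Fin.val_succ]; omega
  rw [this]

theorem abs_digitSum_lt {α : Type*} (f : α → ℤ) (hf : ∀ a, |f a| ≤ 1) {n : ℕ}
    (w : Fin n → α) : |digitSum f w| < 2 ^ n := by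
  induction n with
  | zero => simp [digitSum]
  | succ n ih =>
    rw [digitSum_succ, abs_lt, pow_succ]
    have h1 := abs_lt.1 (ih fun i => w i.succ)
    have h2 := abs_le.1 (hf (w 0))
    have : (0 : ℤ) < 2 ^ n := by positivity
    constructor <;> nlinarith

theorem digitSum_nonneg {α : Type*} (f : α → ℤ) (hf : ∀ a, 0 ≤ f a) {n : ℕ}
    (w : Fin n → α) : 0 ≤ digitSum f w :=
  Finset.sum_nonneg fun i _ => mul_nonneg (hf _) (by positivity)

theorem exists_digitSum_eq {n : ℕ} {x : ℤ} (h0 : 0 ≤ x) (hx : x < 2 ^ n) :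
    ∃ w : Fin n → Bool, digitSum (fun b => if b then 1 else 0) w = x := by
  induction n generalizing x with
  | zero => exact ⟨fun _ => false, by simp [digitSum]; omega⟩
  | succ n ih =>
    rw [pow_succ] at hx
    by_cases h : x < 2 ^ n
    · obtain ⟨w, hw⟩ := ih h0 h
      exact ⟨Fin.cons false w, by simp [digitSum_succ, hw]⟩
    · obtain ⟨w, hw⟩ := ih (x := x - 2 ^ n) (by omega) (by omega)
      exact ⟨Fin.cons true w, by simp [digitSum_succ, hw]⟩

/-- The integer vectors attached to the digits `0`, `1` and `p / q`. -/
def digitVec : Fin 3 → ℤ × ℤ := ![(0, 0), (0, -1), (1, 0)]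

/-- First coordinate of the difference of two digits. -/
def diffFst (l : Fin 3 × Fin 3) : ℤ := (digitVec l.1).1 - (digitVec l.2).1

/-- Second coordinate of the difference of two digits. -/
def diffSnd (l : Fin 3 × Fin 3) : ℤ := (digitVec l.1).2 - (digitVec l.2).2

theorem abs_diffFst_le (l : Fin 3 × Fin 3) : |diffFst l| ≤ 1 := by
  revert l; decide

theorem abs_diffSnd_le (l : Fin 3 × Fin 3) : |diffSnd l| ≤ 1 := by
  revert l; decide

/-- The number of pairs of words of length `n` whose difference has value `(x, y)`. -/
def diffCount (n : ℕ) (x y : ℤ) : ℕ :=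
  ((Finset.univ : Finset (Fin n → Fin 3 × Fin 3)).filter fun w =>
    digitSum diffFst w = x ∧ digitSum diffSnd w = y).card

theorem diffCount_succ (n : ℕ) (x y : ℤ) :
    diffCount (n + 1) x y =
      ∑ l, diffCount n (x - diffFst l * 2 ^ n) (y - diffSnd l * 2 ^ n) := by
  simp only [diffCount, Finset.card_filter]
  rw [← Fintype.sum_prod_type' (f := fun (l : Fin 3 × Fin 3) (w : Fin n → Fin 3 × Fin 3) =>
    if digitSum diffFst w = x - diffFst l * 2 ^ n ∧ digitSum diffSnd w = y - diffSnd l * 2 ^ n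
    then 1 else 0)]
  refine Fintype.sum_equiv (Fin.consEquiv fun _ => Fin 3 × Fin 3).symm _ _ fun w => ?_
  simp only [Fin.consEquiv, Equiv.coe_fn_symm_mk, digitSum_succ]
  refine if_congr ?_ rfl rfl
  change _ ↔ digitSum diffFst (fun i => w i.succ) = x - diffFst (w 0) * 2 ^ n ∧
    digitSum diffSnd (fun i => w i.succ) = y - diffSnd (w 0) * 2 ^ n
  constructor <;> rintro ⟨h1, h2⟩ <;> constructor <;> linarith

theorem diffCount_neg (n : ℕ) (x y : ℤ) : diffCount n (-x) (-y) = diffCount n x y := by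
  induction n generalizing x y with
  | zero => simp [diffCount, digitSum, eq_comm]
  | succ n ih =>
    rw [diffCount_succ, diffCount_succ]
    refine Fintype.sum_equiv (Equiv.prodComm _ _) _ _ fun l => ?_
    rw [← ih]
    congr 1 <;> simp [diffFst, diffSnd] <;> ring

theorem diffCount_eq_zero {n : ℕ} {x y : ℤ} (h : 2 ^ n ≤ |x| ∨ 2 ^ n ≤ |y|) :
    diffCount n x y = 0 := by
  rw [diffCount, Finset.card_eq_zero, Finset.filter_eq_empty_iff]
  rintro w - ⟨rfl, rfl⟩
  have h1 := abs_digitSum_lt _ abs_diffFst_le w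
  have h2 := abs_digitSum_lt _ abs_diffSnd_le w
  omega

/-- The four carries indexing the rows and columns of `Amat`. -/
def carry : Fin 4 → ℤ × ℤ := ![(0, 0), (1, 0), (0, 1), (1, 1)]

theorem Amat_eq_card (b : Bool × Bool) (i j : Fin 4) :
    Amat b i j = (((Finset.univ : Finset (Fin 3 × Fin 3)).filter fun l =>
      (if b.1 then 1 else 0) - 2 * (carry i).1 - diffFst l = -(carry j).1 ∧
      (if b.2 then 1 else 0) - 2 * (carry i).2 - diffSnd l = -(carry j).2).card : ℝ) := by
  have key : ((match b with
    | (false, false) => !![3,1,1,1; 0,1,0,0; 0,0,1,0; 0,0,0,1]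
    | (true, false)  => !![1,0,1,0; 1,3,0,1; 0,0,0,0; 0,0,1,1]
    | (false, true)  => !![1,1,0,0; 0,0,0,0; 1,0,3,1; 0,1,0,1]
    | (true, true)   => !![1,0,0,0; 0,1,0,0; 0,0,1,0; 1,1,1,3] : Matrix (Fin 4) (Fin 4) ℕ) i j) =
    ((Finset.univ : Finset (Fin 3 × Fin 3)).filter fun l =>
      (if b.1 then 1 else 0) - 2 * (carry i).1 - diffFst l = -(carry j).1 ∧
      (if b.2 then 1 else 0) - 2 * (carry i).2 - diffSnd l = -(carry j).2).card := by
    obtain ⟨b₁, b₂⟩ := b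
    cases b₁ <;> cases b₂ <;> fin_cases i <;> fin_cases j <;> decide
  rw [← key]
  obtain ⟨b₁, b₂⟩ := b
  cases b₁ <;> cases b₂ <;> fin_cases i <;> fin_cases j <;> simp [Amat]

/-- The first column of the product `A_z` for a finite word `z`. -/
def wordCol {n : ℕ} (z : Fin n → Bool × Bool) (i : Fin 4) : ℝ :=
  (List.ofFn fun k => Amat (z k)).prod i 0

theorem wordCol_succ {n : ℕ} (z : Fin (n + 1) → Bool × Bool) (i : Fin 4) :
    wordCol z i = ∑ j, Amat (z 0) i j * wordCol (fun k => z k.succ) j := by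
  simp [wordCol, List.ofFn_succ, Matrix.mul_apply]

theorem wordCol_nonneg {n : ℕ} (z : Fin n → Bool × Bool) (i : Fin 4) : 0 ≤ wordCol z i := by
  induction n generalizing i with
  | zero => simp only [wordCol, List.ofFn_zero, List.prod_nil, Matrix.one_apply]; positivity
  | succ n ih =>
    rw [wordCol_succ]
    exact Finset.sum_nonneg fun j _ => mul_nonneg (by rw [Amat_eq_card]; positivity) (ih _ _)

/-- Value of the first coordinates of a binary word. -/
def bitsFst {n : ℕ} (z : Fin n → Bool × Bool) : ℤ :=
  digitSum (fun b => if b.1 then 1 else 0) z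

/-- Value of the second coordinates of a binary word. -/
def bitsSnd {n : ℕ} (z : Fin n → Bool × Bool) : ℤ :=
  digitSum (fun b => if b.2 then 1 else 0) z

theorem bitsFst_mem {n : ℕ} (z : Fin n → Bool × Bool) : 0 ≤ bitsFst z ∧ bitsFst z < 2 ^ n :=
  ⟨digitSum_nonneg _ (fun b => by split <;> simp) z,
    (abs_lt.1 (abs_digitSum_lt _ (fun b => by split <;> simp) z)).2⟩

theorem bitsSnd_mem {n : ℕ} (z : Fin n → Bool × Bool) : 0 ≤ bitsSnd z ∧ bitsSnd z < 2 ^ n :=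
  ⟨digitSum_nonneg _ (fun b => by split <;> simp) z,
    (abs_lt.1 (abs_digitSum_lt _ (fun b => by split <;> simp) z)).2⟩

theorem le_abs_add_mul {N x k : ℤ} (h0 : 0 ≤ x) (hx : x < N) (hk : k ≠ 0) (hk' : k ≠ -1) :
    N ≤ |x + k * N| := by
  rcases lt_or_gt_of_ne hk with h | h
  · exact le_abs.2 (Or.inr (by nlinarith [show k ≤ -2 by omega]))
  · exact le_abs.2 (Or.inl (by nlinarith))

/-- Each entry of the column of `A_z` bounds the number of differences congruent to `z` with the
corresponding carry. -/
theorem diffCount_le_wordCol {n : ℕ} (z : Fin n → Bool × Bool) (i : Fin 4) :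
    (diffCount n (bitsFst z - (carry i).1 * 2 ^ n) (bitsSnd z - (carry i).2 * 2 ^ n) : ℝ)
      ≤ wordCol z i := by
  induction n generalizing i with
  | zero =>
    fin_cases i <;>
      simp [diffCount, wordCol, bitsFst, bitsSnd, digitSum, carry]
  | succ n ih =>
    set z' : Fin n → Bool × Bool := fun k => z k.succ with hz'
    have hshift : ∀ k m : ℤ, (diffCount n (bitsFst z' + k * 2 ^ n) (bitsSnd z' + m * 2 ^ n) : ℝ)
        ≤ ∑ j, (if k = -(carry j).1 ∧ m = -(carry j).2 then (1 : ℝ) else 0) * wordCol z' j := by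
      intro k m
      have hnn : ∀ j ∈ (Finset.univ : Finset (Fin 4)),
          0 ≤ (if k = -(carry j).1 ∧ m = -(carry j).2 then (1 : ℝ) else 0) * wordCol z' j :=
        fun j _ => mul_nonneg (by split <;> norm_num) (wordCol_nonneg _ _)
      by_cases h : ∃ j, k = -(carry j).1 ∧ m = -(carry j).2
      · obtain ⟨j, hj⟩ := h
        refine le_trans ?_ (Finset.single_le_sum hnn (Finset.mem_univ j))
        rw [if_pos hj, one_mul, hj.1, hj.2]
        simpa only [neg_mul, ← sub_eq_add_neg] using ih z' j
      · have h4 : (k ≠ 0 ∧ k ≠ -1) ∨ (m ≠ 0 ∧ m ≠ -1) := by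
          by_contra hcon
          apply h
          have e1 : k = 0 ∨ k = -1 := by omega
          have e2 : m = 0 ∨ m = -1 := by omega
          rcases e1 with rfl | rfl <;> rcases e2 with rfl | rfl <;> decide
        rw [diffCount_eq_zero]
        · simpa using Finset.sum_nonneg hnn
        · exact h4.imp
            (fun h => le_abs_add_mul (bitsFst_mem z').1 (bitsFst_mem z').2 h.1 h.2)
            (fun h => le_abs_add_mul (bitsSnd_mem z').1 (bitsSnd_mem z').2 h.1 h.2)
    rw [diffCount_succ, wordCol_succ]
    push_cast
    calc _ ≤ ∑ l, ∑ j, (if (if (z 0).1 then 1 else 0) - 2 * (carry i).1 - diffFst l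
              = -(carry j).1 ∧ (if (z 0).2 then 1 else 0) - 2 * (carry i).2 - diffSnd l
              = -(carry j).2 then (1 : ℝ) else 0) * wordCol z' j := by
          refine Finset.sum_le_sum fun l _ => le_trans (le_of_eq ?_) (hshift _ _)
          congr 2 <;> simp only [bitsFst, bitsSnd, digitSum_succ, pow_succ] <;> ring
      _ = _ := by
          rw [Finset.sum_comm]
          refine Finset.sum_congr rfl fun j _ => ?_
          rw [← Finset.sum_mul, Amat_eq_card, Finset.card_filter]
          push_cast
          rfl

theorem mem_Zset {p q n : ℕ} {z : Fin n → Bool × Bool} :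
    z ∈ Zset p q n ↔ (p : ℤ) * bitsFst z = q * bitsSnd z := by
  simp only [Zset, Finset.mem_filter, Finset.mem_univ, true_and, bitsFst, bitsSnd, digitSum]
  rw [← Int.natCast_inj]
  push_cast
  rfl

/-- The index of a digit of `Dset p q` in the list `0, 1, p / q`. -/
def digitIndex (d : ℚ) : Fin 3 := if d = 0 then 0 else if d = 1 then 1 else 2

theorem eq_of_mem_Dset {p q : ℕ} {d : ℚ} (hd : d ∈ Dset p q) :
    d = (p : ℚ) / q * (digitVec (digitIndex d)).1 - (digitVec (digitIndex d)).2 := by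
  unfold digitIndex
  split_ifs with h0 h1
  · simp [digitVec, h0]
  · simp [digitVec, h1]
  · simp only [Dset, Finset.mem_insert, Finset.mem_singleton, h0, h1, false_or] at hd
    simp [digitVec, hd]

theorem valD_eq_digitSum {p q n : ℕ} (hq : 0 < q) {a : Fin n → ℚ} (ha : a ∈ Dwords p q n) :
    (q : ℚ) * 2 ^ n * valD a = p * digitSum (fun d => (digitVec (digitIndex d)).1) a
      - q * digitSum (fun d => (digitVec (digitIndex d)).2) a := by
  have hq' : (q : ℚ) ≠ 0 := by positivity
  simp only [valD, digitSum]
  push_cast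
  simp only [Finset.mul_sum]
  rw [← Finset.sum_sub_distrib]
  refine Finset.sum_congr rfl fun i _ => ?_
  have hi : (2 : ℚ) ^ n = 2 ^ (n - 1 - (i : ℕ)) * 2 ^ ((i : ℕ) + 1) := by
    rw [← pow_add]; congr 1; omega
  have hd := eq_of_mem_Dset (Fintype.mem_piFinset.1 ha i)
  generalize (digitVec (digitIndex (a i))).1 = x at *
  generalize (digitVec (digitIndex (a i))).2 = y at *
  rw [hd, hi]
  field_simp

theorem digitSum_diff {α β : Type*} (f : β → ℤ) (e : α → β) {n : ℕ} (a b : Fin n → α) :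
    digitSum (fun l : β × β => f l.1 - f l.2) (fun i => (e (a i), e (b i))) =
      digitSum (fun d => f (e d)) a - digitSum (fun d => f (e d)) b := by
  simp only [digitSum, sub_mul, Finset.sum_sub_distrib]

theorem Ncount_le_card {p q : ℕ} (hq : 0 < q) (n : ℕ) :
    Ncount p q n ≤ ((Finset.univ : Finset (Fin n → Fin 3 × Fin 3)).filter fun w =>
      (p : ℤ) * digitSum diffFst w = q * digitSum diffSnd w).card := by
  refine Finset.card_le_card_of_injOn
    (fun ab i => (digitIndex (ab.1 i), digitIndex (ab.2 i))) ?_ ?_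
  · rintro ⟨a, b⟩ hab
    simp only [Finset.coe_filter, Finset.mem_product, Set.mem_ofPred_eq] at hab
    obtain ⟨⟨ha, hb⟩, hv⟩ := hab
    have h1 := valD_eq_digitSum hq ha
    have h2 := valD_eq_digitSum hq hb
    simp only [Finset.coe_filter, Finset.mem_univ, true_and, Set.mem_ofPred_eq]
    have e1 := digitSum_diff (fun l => (digitVec l).1) digitIndex a b
    have e2 := digitSum_diff (fun l => (digitVec l).2) digitIndex a b
    change (p : ℤ) * digitSum (fun l : Fin 3 × Fin 3 => (digitVec l.1).1 - (digitVec l.2).1) _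
      = q * digitSum (fun l : Fin 3 × Fin 3 => (digitVec l.1).2 - (digitVec l.2).2) _
    rw [e1, e2, ← @Int.cast_inj ℚ]
    push_cast
    rw [hv] at h1
    linarith
  · rintro ⟨a, b⟩ hab ⟨a', b'⟩ hab' heq
    simp only [Finset.coe_filter, Finset.mem_product, Set.mem_ofPred_eq, Dwords,
      Fintype.mem_piFinset] at hab hab'
    have hi := fun i => Prod.ext_iff.1 (congrFun heq i)
    simp only at hi
    ext i
    · simp only
      rw [eq_of_mem_Dset (hab.1.1 i), eq_of_mem_Dset (hab'.1.1 i), (hi i).1]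
    · simp only
      rw [eq_of_mem_Dset (hab.1.2 i), eq_of_mem_Dset (hab'.1.2 i), (hi i).2]

theorem exists_bits_eq {n : ℕ} {x y : ℤ} (hx0 : 0 ≤ x) (hx : x < 2 ^ n) (hy0 : 0 ≤ y)
    (hy : y < 2 ^ n) : ∃ z : Fin n → Bool × Bool, bitsFst z = x ∧ bitsSnd z = y := by
  obtain ⟨s, hs⟩ := exists_digitSum_eq hx0 hx
  obtain ⟨t, ht⟩ := exists_digitSum_eq hy0 hy
  exact ⟨fun i => (s i, t i), hs, ht⟩

theorem Ncount_le_sum_diffCount {p q : ℕ} (hp : 0 < p) (hq : 0 < q) (n : ℕ) :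
    Ncount p q n ≤ ∑ z ∈ Zset p q n, 2 * diffCount n (bitsFst z) (bitsSnd z) := by
  refine (Ncount_le_card hq n).trans ?_
  calc _ ≤ ((Zset p q n).biUnion fun z =>
        (Finset.univ.filter fun w : Fin n → Fin 3 × Fin 3 =>
          digitSum diffFst w = bitsFst z ∧ digitSum diffSnd w = bitsSnd z) ∪
        (Finset.univ.filter fun w : Fin n → Fin 3 × Fin 3 =>
          digitSum diffFst w = -bitsFst z ∧ digitSum diffSnd w = -bitsSnd z)).card := by
        refine Finset.card_le_card fun w hw => ?_
        simp only [Finset.mem_filter, Finset.mem_univ, true_and] at hw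
        have h1 := abs_lt.1 (abs_digitSum_lt _ abs_diffFst_le w)
        have h2 := abs_lt.1 (abs_digitSum_lt _ abs_diffSnd_le w)
        have hp' : (0 : ℤ) < p := by exact_mod_cast hp
        have hq' : (0 : ℤ) < q := by exact_mod_cast hq
        simp only [Finset.mem_biUnion, Finset.mem_union, Finset.mem_filter, Finset.mem_univ,
          true_and]
        rcases le_total 0 (digitSum diffFst w) with h | h
        · have h' : 0 ≤ digitSum diffSnd w :=
            nonneg_of_mul_nonneg_right (hw ▸ mul_nonneg hp'.le h) hq'
          obtain ⟨z, hz1, hz2⟩ := exists_bits_eq h h1.2 h' h2.2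
          exact ⟨z, mem_Zset.2 (by rw [hz1, hz2, hw]), Or.inl ⟨hz1.symm, hz2.symm⟩⟩
        · have h' : digitSum diffSnd w ≤ 0 := by
            by_contra hc
            nlinarith [mul_pos hq' (not_le.1 hc), mul_nonneg hp'.le (neg_nonneg.2 h)]
          obtain ⟨z, hz1, hz2⟩ := exists_bits_eq (n := n) (neg_nonneg.2 h) (by linarith)
            (neg_nonneg.2 h') (by linarith)
          exact ⟨z, mem_Zset.2 (by rw [hz1, hz2]; linarith), Or.inr ⟨by omega, by omega⟩⟩
    _ ≤ _ := by
        refine Finset.card_biUnion_le.trans (Finset.sum_le_sum fun z _ => ?_)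
        refine (Finset.card_union_le _ _).trans (le_of_eq ?_)
        change diffCount n (bitsFst z) (bitsSnd z) + diffCount n (-bitsFst z) (-bitsSnd z) = _
        rw [diffCount_neg, two_mul]

theorem Ncount_le_sum_wordCol {p q : ℕ} (hp : 0 < p) (hq : 0 < q) (n : ℕ) :
    (Ncount p q n : ℝ) ≤ 2 * ∑ z ∈ Zset p q n, ∑ i, wordCol z i := by
  have h : (Ncount p q n : ℝ) ≤
      ((∑ z ∈ Zset p q n, 2 * diffCount n (bitsFst z) (bitsSnd z) : ℕ) : ℝ) := by
    exact_mod_cast Ncount_le_sum_diffCount hp hq n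
  refine h.trans ?_
  push_cast
  rw [Finset.mul_sum]
  refine Finset.sum_le_sum fun z _ => mul_le_mul_of_nonneg_left ?_ (by norm_num)
  refine le_trans ?_
    (Finset.single_le_sum (fun i _ => wordCol_nonneg z i) (Finset.mem_univ (0 : Fin 4)))
  simpa [carry] using diffCount_le_wordCol z 0

theorem one_le_Ncount (p q n : ℕ) : 1 ≤ Ncount p q n := by
  refine Finset.card_pos.2 ⟨(fun _ => 0, fun _ => 0), ?_⟩
  simp [Dwords, Dset, Fintype.mem_piFinset]

theorem Wpre_eq_sum_wordCol (ω : ℕ → Bool × Bool) (n : ℕ) :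
    Wpre ω n = ∑ i, wordCol (fun k : Fin n => ω k) i := rfl

theorem Wpre_zero (ω : ℕ → Bool × Bool) : Wpre ω 0 = 1 := by
  simp [Wpre, Matrix.one_apply]

theorem Wpre_succ_eq (ω : ℕ → Bool × Bool) (n : ℕ) :
    Wpre ω (n + 1) =
      ∑ j, (∑ i, Amat (ω 0) i j) * wordCol (fun k : Fin n => ω (k + 1)) j := by
  simp only [Wpre_eq_sum_wordCol, wordCol_succ, Finset.sum_mul]
  rw [Finset.sum_comm]
  rfl

theorem Amat_colSum_mem (b : Bool × Bool) (j : Fin 4) :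
    1 ≤ ∑ i, Amat b i j ∧ ∑ i, Amat b i j ≤ 3 := by
  obtain ⟨b₁, b₂⟩ := b
  cases b₁ <;> cases b₂ <;> fin_cases j <;> simp [Amat, Fin.sum_univ_succ] <;> norm_num

theorem Wpre_le_succ (ω : ℕ → Bool × Bool) (n : ℕ) :
    Wpre (fun i => ω (i + 1)) n ≤ Wpre ω (n + 1) := by
  rw [Wpre_succ_eq, Wpre_eq_sum_wordCol]
  exact Finset.sum_le_sum fun j _ =>
    le_mul_of_one_le_left (wordCol_nonneg _ _) (Amat_colSum_mem _ _).1

theorem Wpre_succ_le (ω : ℕ → Bool × Bool) (n : ℕ) :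
    Wpre ω (n + 1) ≤ 3 * Wpre (fun i => ω (i + 1)) n := by
  rw [Wpre_succ_eq, Wpre_eq_sum_wordCol, Finset.mul_sum]
  exact Finset.sum_le_sum fun j _ =>
    mul_le_mul_of_nonneg_right (Amat_colSum_mem _ _).2 (wordCol_nonneg _ _)

theorem one_le_Wpre (ω : ℕ → Bool × Bool) (n : ℕ) : 1 ≤ Wpre ω n := by
  induction n generalizing ω with
  | zero => rw [Wpre_zero]
  | succ n ih => exact (ih _).trans (Wpre_le_succ ω n)

theorem phi_le_log_three (ω : ℕ → Bool × Bool) : phi ω ≤ Real.log 3 := by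
  have hpos := fun (ω : ℕ → Bool × Bool) n => zero_lt_one.trans_le (one_le_Wpre ω n)
  have hge : ∀ᶠ n in Filter.atTop,
      0 ≤ Real.log (Wpre ω n / Wpre (fun i => ω (i + 1)) (n - 1)) := by
    filter_upwards [Filter.eventually_ge_atTop 1] with n hn
    obtain ⟨m, rfl⟩ := Nat.exists_eq_add_of_le' hn
    exact Real.log_nonneg ((one_le_div (hpos _ _)).2 (Wpre_le_succ ω m))
  refine Filter.limsup_le_of_le (Filter.IsBoundedUnder.isCoboundedUnder_le ⟨0, ?_⟩) ?_
  · simpa using hge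
  · filter_upwards [Filter.eventually_ge_atTop 1] with n hn
    obtain ⟨m, rfl⟩ := Nat.exists_eq_add_of_le' hn
    exact Real.log_le_log (div_pos (hpos _ _) (hpos _ _))
      ((div_le_iff₀ (hpos _ _)).2 (Wpre_succ_le ω m))

theorem Wpre_add_of_eventually_zero {ω : ℕ → Bool × Bool} {N : ℕ}
    (h : ∀ i, N ≤ i → ω i = (false, false)) (k : ℕ) : Wpre ω (N + k) = 3 ^ k * Wpre ω N := by
  induction k with
  | zero => simp
  | succ k ih =>
    rw [pow_succ', mul_assoc, ← ih, ← add_assoc]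
    simp only [Wpre]
    rw [List.ofFn_succ_last, List.prod_append, List.prod_singleton]
    simp only [Fin.val_last, h (N + k) (by omega), Fin.val_castSucc]
    rw [Finset.mul_sum]
    refine Finset.sum_congr rfl fun i _ => ?_
    rw [Matrix.mul_apply, Fin.sum_univ_four]
    simp [Amat, mul_comm]

theorem phi_of_eventually_zero {ω : ℕ → Bool × Bool} {N : ℕ}
    (h : ∀ i, N + 1 ≤ i → ω i = (false, false)) :
    phi ω = Real.log (Wpre ω (N + 1)) - Real.log (Wpre (fun i => ω (i + 1)) N) := by
  have hne := fun (ω : ℕ → Bool × Bool) n => (zero_lt_one.trans_le (one_le_Wpre ω n)).ne'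
  refine Filter.Tendsto.limsup_eq (tendsto_const_nhds.congr' ?_)
  filter_upwards [Filter.eventually_ge_atTop (N + 1)] with n hn
  obtain ⟨k, rfl⟩ := Nat.exists_eq_add_of_le hn
  rw [Wpre_add_of_eventually_zero h, show N + 1 + k - 1 = N + k by omega,
    Wpre_add_of_eventually_zero (fun i hi => h (i + 1) (by omega)),
    mul_div_mul_left _ _ (by positivity), Real.log_div (hne _ _) (hne _ _)]

theorem sum_phi_of_eventually_zero {ω : ℕ → Bool × Bool} {n : ℕ}
    (h : ∀ i, n ≤ i → ω i = (false, false)) :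
    ∑ j ∈ Finset.range n, phi (fun i => ω (i + j)) = Real.log (Wpre ω n) := by
  have key : ∀ j ∈ Finset.range n, phi (fun i => ω (i + j)) =
      Real.log (Wpre (fun i => ω (i + j)) (n - j)) -
        Real.log (Wpre (fun i => ω (i + (j + 1))) (n - (j + 1))) := by
    intro j hj
    rw [Finset.mem_range] at hj
    rw [phi_of_eventually_zero (N := n - (j + 1)) (fun i hi => h _ (by omega)),
      show n - (j + 1) + 1 = n - j by omega]
    simp only [add_assoc, add_comm 1 j]
  rw [Finset.sum_congr rfl key,
    Finset.sum_range_sub' (fun j => Real.log (Wpre (fun i => ω (i + j)) (n - j)))]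
  simp [Wpre_zero]

/-- The infinite sequence extending a finite word by zeros. -/
def extendZero {n : ℕ} (z : Fin n → Bool × Bool) (i : ℕ) : Bool × Bool :=
  if h : i < n then z ⟨i, h⟩ else (false, false)

theorem extendZero_val {n : ℕ} (z : Fin n → Bool × Bool) (i : Fin n) :
    extendZero z i = z i := by
  simp [extendZero]

theorem extendZero_of_le {n : ℕ} (z : Fin n → Bool × Bool) (i : ℕ) (hi : n ≤ i) :
    extendZero z i = (false, false) := by
  simp [extendZero, hi]

theorem tsum_extendZero {n : ℕ} (z : Fin n → Bool × Bool) (π : Bool × Bool → Bool)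
    (hπ : π (false, false) = false) :
    ∑' i : ℕ, (if π (extendZero z i) then (1 : ℝ) else 0) / 2 ^ (i + 1) =
      digitSum (fun b => if π b then 1 else 0) z / 2 ^ n := by
  rw [tsum_eq_sum (s := Finset.range n), Finset.sum_range, digitSum]
  · push_cast
    rw [Finset.sum_div]
    refine Finset.sum_congr rfl fun i _ => ?_
    have hi : (2 : ℝ) ^ n = 2 ^ (n - 1 - (i : ℕ)) * 2 ^ ((i : ℕ) + 1) := by
      rw [← pow_add]; congr 1; omega
    rw [extendZero_val, hi]
    field_simp
  · intro i hi
    rw [extendZero_of_le z i (by simpa using hi), hπ]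
    simp

theorem extendZero_mem_Xtheta {p q n : ℕ} (hq : 0 < q) {z : Fin n → Bool × Bool}
    (hz : z ∈ Zset p q n) : extendZero z ∈ Xtheta p q := by
  have hq' : (q : ℝ) ≠ 0 := by positivity
  have hpos : (0 : ℝ) < 2 ^ n := by positivity
  have hZ : (p : ℝ) * bitsFst z = q * bitsSnd z := by exact_mod_cast mem_Zset.1 hz
  have hfract : ∀ x : ℤ, 0 ≤ x ∧ x < 2 ^ n → Int.fract ((x : ℝ) / 2 ^ n) = x / 2 ^ n := by
    intro x hx
    refine Int.fract_eq_self.2 ⟨div_nonneg (by exact_mod_cast hx.1) hpos.le, ?_⟩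
    rw [div_lt_one hpos]
    exact_mod_cast hx.2
  refine ⟨bitsFst z / 2 ^ n, ?_, ?_⟩
  · rw [tsum_extendZero z Prod.fst rfl, hfract _ (bitsFst_mem z)]
    rfl
  · rw [tsum_extendZero z Prod.snd rfl,
      show (p : ℝ) / q * (bitsFst z / 2 ^ n) = bitsSnd z / 2 ^ n by
        field_simp; linarith, hfract _ (bitsSnd_mem z)]
    rfl

theorem sum_phi_le (ω : ℕ → Bool × Bool) (n : ℕ) :
    ∑ j ∈ Finset.range n, phi (fun i => ω (i + j)) ≤ n * Real.log 3 := by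
  refine (Finset.sum_le_card_nsmul _ _ _ fun j _ => phi_le_log_three _).trans ?_
  simp

/-- The supremum over the cylinder `[z]` of the Birkhoff sums of `phi`. -/
noncomputable def cylinderSup (p q : ℕ) {n : ℕ} (z : Fin n → Bool × Bool) : ℝ :=
  sSup ((fun ω => ∑ j ∈ Finset.range n, phi fun i => ω (i + j)) ''
    {ω | ω ∈ Xtheta p q ∧ ∀ i : Fin n, ω (i : ℕ) = z i})

theorem cylinderSup_le (p q : ℕ) {n : ℕ} (z : Fin n → Bool × Bool) :
    cylinderSup p q z ≤ n * Real.log 3 := by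
  refine Real.sSup_le ?_ (mul_nonneg n.cast_nonneg (Real.log_nonneg (by norm_num)))
  rintro _ ⟨ω, -, rfl⟩
  exact sum_phi_le ω n

theorem wordCol_sum_le_exp_cylinderSup {p q n : ℕ} (hq : 0 < q) {z : Fin n → Bool × Bool}
    (hz : z ∈ Zset p q n) : ∑ i, wordCol z i ≤ Real.exp (cylinderSup p q z) := by
  have hW : Wpre (extendZero z) n = ∑ i, wordCol z i := by
    simp only [Wpre_eq_sum_wordCol, extendZero_val]
  rw [← hW, ← Real.log_le_iff_le_exp (zero_lt_one.trans_le (one_le_Wpre _ _)),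
    ← sum_phi_of_eventually_zero (extendZero_of_le z)]
  refine le_csSup ⟨n * Real.log 3, ?_⟩
    ⟨extendZero z, ⟨extendZero_mem_Xtheta hq hz, extendZero_val z⟩, rfl⟩
  rintro _ ⟨ω, -, rfl⟩
  exact sum_phi_le ω n

theorem Ncount_le_partition {p q : ℕ} (hp : 0 < p) (hq : 0 < q) (n : ℕ) :
    (Ncount p q n : ℝ) ≤ 2 * ∑ z ∈ Zset p q n, Real.exp (cylinderSup p q z) :=
  (Ncount_le_sum_wordCol hp hq n).trans <| mul_le_mul_of_nonneg_left
    (Finset.sum_le_sum fun _ hz => wordCol_sum_le_exp_cylinderSup hq hz) (by norm_num)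

theorem partition_le (p q n : ℕ) :
    ∑ z ∈ Zset p q n, Real.exp (cylinderSup p q z) ≤ 12 ^ n := by
  calc _ ≤ ∑ z : Fin n → Bool × Bool, Real.exp (cylinderSup p q z) :=
        Finset.sum_le_sum_of_subset_of_nonneg (Finset.subset_univ _)
          fun _ _ _ => (Real.exp_pos _).le
    _ ≤ ∑ _z : Fin n → Bool × Bool, (3 : ℝ) ^ n := by
        refine Finset.sum_le_sum fun z _ => ?_
        rw [← Real.exp_log (show (0 : ℝ) < 3 ^ n by positivity), Real.log_pow]
        exact Real.exp_le_exp.2 (cylinderSup_le p q z)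
    _ = 12 ^ n := by
        simp only [Finset.sum_const, Finset.card_univ, Fintype.card_pi, Fintype.card_prod,
          Fintype.card_bool, Finset.prod_const, Fintype.card_fin, nsmul_eq_mul]
        push_cast
        rw [← mul_pow]
        norm_num

/-- A sequence of counts `N` with `1 ≤ N ≤ C * S` and `S` at most exponential does not grow
exponentially faster than `S`. -/
theorem limsup_log_le_of_le_mul {N S : ℕ → ℝ} {C K : ℝ} (hC : 1 ≤ C) (hN : ∀ n, 1 ≤ N n)
    (hNS : ∀ n, N n ≤ C * S n) (hS : ∀ n, S n ≤ K ^ n) (hK : 1 ≤ K) :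
    Filter.limsup (fun n : ℕ => (1 / (n : ℝ)) * Real.log (N n)) Filter.atTop ≤
      Filter.limsup (fun n : ℕ => (1 / (n : ℝ)) * Real.log (S n)) Filter.atTop := by
  have hC0 : 0 < C := zero_lt_one.trans_le hC
  have hS0 : ∀ n, 0 < S n := fun n =>
    pos_of_mul_pos_right (zero_lt_one.trans_le ((hN n).trans (hNS n))) hC0.le
  set c : ℕ → ℝ := fun n => (1 / (n : ℝ)) * Real.log C with hc
  set v : ℕ → ℝ := fun n => (1 / (n : ℝ)) * Real.log (S n) with hv
  have hlim : Filter.Tendsto c Filter.atTop (nhds 0) := by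
    simpa [hc] using tendsto_one_div_atTop_nhds_zero_nat.mul_const (Real.log C)
  have hle : ∀ n : ℕ, (1 / (n : ℝ)) * Real.log (N n) ≤ c n + v n := fun n => by
    rw [hc, hv]
    dsimp only
    rw [← mul_add, ← Real.log_mul hC0.ne' (hS0 n).ne']
    exact mul_le_mul_of_nonneg_left
      (Real.log_le_log (zero_lt_one.trans_le (hN n)) (hNS n)) (by positivity)
  have hnn : ∀ n : ℕ, 0 ≤ (1 / (n : ℝ)) * Real.log (N n) := fun n =>
    mul_nonneg (by positivity) (Real.log_nonneg (hN n))
  have hv_le : Filter.IsBoundedUnder (· ≤ ·) Filter.atTop v := by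
    refine Filter.isBoundedUnder_of ⟨Real.log K, fun n => ?_⟩
    rcases Nat.eq_zero_or_pos n with rfl | hn
    · simpa [hv] using Real.log_nonneg hK
    · have hn' : (0 : ℝ) < n := by exact_mod_cast hn
      have := Real.log_le_log (hS0 n) (hS n)
      rw [Real.log_pow] at this
      rw [hv]
      dsimp only
      rw [one_div, inv_mul_le_iff₀ hn']
      exact this
  have hv_ge : Filter.IsBoundedUnder (· ≥ ·) Filter.atTop v := by
    obtain ⟨B, hB⟩ := hlim.isBoundedUnder_le
    refine ⟨-B, ?_⟩
    rw [Filter.eventually_map] at hB ⊢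
    filter_upwards [hB] with n hn
    have := hle n
    have := hnn n
    simp only [ge_iff_le] at hn ⊢
    linarith
  calc _ ≤ Filter.limsup (c + v) Filter.atTop :=
        Filter.limsup_le_limsup (Filter.Eventually.of_forall hle)
          (Filter.isBoundedUnder_of ⟨0, hnn⟩).isCoboundedUnder_le
          (Filter.isBoundedUnder_le_add hlim.isBoundedUnder_le hv_le)
    _ ≤ Filter.limsup c Filter.atTop + Filter.limsup v Filter.atTop :=
        limsup_add_le hlim.isBoundedUnder_ge hlim.isBoundedUnder_le
          hv_ge.isCoboundedUnder_le hv_le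
    _ = _ := by rw [hlim.limsup_eq, zero_add]

/-- the exponential growth rate of the number of exact overlaps is
bounded by the topological pressure of `φ` on the extended line:
`limsup (1/n) log N_n ≤ limsup (1/n) log ∑_{z ∈ Z_n} exp( sup_{ω ∈ [z]} ∑_{j<n} φ(σ^j ω) )`. -/
theorem stmt_11 (p q : ℕ) (hp : 0 < p) (hq : 0 < q) (hpq : p ≤ q)
    (hcop : Nat.Coprime p q) :
    Filter.limsup (fun n : ℕ => (1 / (n : ℝ)) * Real.log (Ncount p q n))
        Filter.atTop ≤
      Filter.limsup (fun n : ℕ => (1 / (n : ℝ)) * Real.log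
        (∑ z ∈ Zset p q n, Real.exp (sSup
          ((fun ω => ∑ j ∈ Finset.range n, phi fun i => ω (i + j)) ''
            {ω | ω ∈ Xtheta p q ∧ ∀ i : Fin n, ω (i : ℕ) = z i}))))
        Filter.atTop := by
  exact limsup_log_le_of_le_mul (by norm_num) (fun n => by exact_mod_cast one_le_Ncount p q n)
    (Ncount_le_partition hp hq) (partition_le p q) (by norm_num)
end

section
/- Let β be the uniform Bernoulli measure on B^ℕ giving each of the four letters of B probability 1/4 independently in each coordinate. Then for β-almost every ω ∈ B^ℕ, ω is infinitely contractive: there exists a vector u ∈ ℝ⁴ with nonnegative entries summing to 1 such that for every vector x ∈ ℝ⁴ with all entries strictly positive, the normalized products A_{ω_1}A_{ω_2}⋯A_{ω_n} x / ‖A_{ω_1}A_{ω_2}⋯A_{ω_n} x‖₁ converge to u as n → ∞. -/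
open MeasureTheory

/-- The product `A_{ω_1}⋯A_{ω_n}` along the length-`n` prefix of `ω`. -/
def Aprod (ω : ℕ → Bool × Bool) (n : ℕ) : Matrix (Fin 4) (Fin 4) ℝ :=
  (List.ofFn fun k : Fin n => Amat (ω k)).prod

section Contraction

variable {m : Type*} [Fintype m]

/-- `P` maps any two nonnegative vectors whose images have equal coordinate sums to vectors whose
entries differ by at most `d` times that sum. -/
def ContractionBound (P : Matrix m m ℝ) (d : ℝ) : Prop :=
  ∀ x y : m → ℝ, 0 ≤ x → 0 ≤ y → ∑ i, P.mulVec x i = ∑ i, P.mulVec y i →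
    ∀ i, |P.mulVec x i - P.mulVec y i| ≤ d * ∑ j, P.mulVec x j

lemma mulVec_nonneg_of_nonneg {P : Matrix m m ℝ} (hP : ∀ i j, 0 ≤ P i j) {x : m → ℝ}
    (hx : 0 ≤ x) : 0 ≤ P.mulVec x :=
  fun i => Finset.sum_nonneg fun j _ => mul_nonneg (hP i j) (hx j)

lemma contractionBound_one {P : Matrix m m ℝ} (hP : ∀ i j, 0 ≤ P i j) :
    ContractionBound P 1 := by
  intro x y hx hy hxy i
  have hPx := mulVec_nonneg_of_nonneg hP hx
  have hPy := mulVec_nonneg_of_nonneg hP hy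
  have h1 := Finset.single_le_sum (fun j _ => hPx j) (Finset.mem_univ i)
  have h2 := Finset.single_le_sum (fun j _ => hPy j) (Finset.mem_univ i)
  have h3 := hPx i
  have h4 := hPy i
  simp only [Pi.zero_apply] at h3 h4
  rw [abs_le]
  constructor <;> linarith

lemma ContractionBound.mul_nonneg_right {P Q : Matrix m m ℝ} {d : ℝ}
    (h : ContractionBound P d) (hQ : ∀ i j, 0 ≤ Q i j) : ContractionBound (P * Q) d := by
  intro x y hx hy
  simp only [← Matrix.mulVec_mulVec]
  exact h _ _ (mulVec_nonneg_of_nonneg hQ hx) (mulVec_nonneg_of_nonneg hQ hy)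

lemma smul_mulVec_le_of_comparable {M : Matrix m m ℝ} {c : ℝ}
    (hM : ∀ i j k, c * M i k ≤ M i j) {x y : m → ℝ} (hx : 0 ≤ x) (hy : 0 ≤ y) (i : m) :
    (∑ j, x j) * (c * M.mulVec y i) ≤ (∑ k, y k) * M.mulVec x i := by
  have hl : (∑ j, x j) * (c * M.mulVec y i) = ∑ j, ∑ k, x j * y k * (c * M i k) := by
    rw [Finset.sum_mul]
    refine Finset.sum_congr rfl fun j _ => ?_
    simp only [Matrix.mulVec, dotProduct, Finset.mul_sum]
    exact Finset.sum_congr rfl fun k _ => by ring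
  have hr : (∑ k, y k) * M.mulVec x i = ∑ j, ∑ k, x j * y k * M i j := by
    rw [Finset.sum_comm, Finset.sum_mul]
    refine Finset.sum_congr rfl fun j _ => ?_
    simp only [Matrix.mulVec, dotProduct, Finset.mul_sum]
    exact Finset.sum_congr rfl fun k _ => by ring
  rw [hl, hr]
  exact Finset.sum_le_sum fun j _ => Finset.sum_le_sum fun k _ =>
    mul_le_mul_of_nonneg_left (hM i j k) (mul_nonneg (hx j) (hy k))

lemma ContractionBound.mul_comparable {P M : Matrix m m ℝ} {c d : ℝ}
    (h : ContractionBound P d) (hM0 : ∀ i j, 0 ≤ M i j) (hc : c ≤ 1)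
    (hM : ∀ i j k, c * M i k ≤ M i j) : ContractionBound (P * M) (d * (1 - c)) := by
  intro x y hx hy
  wlog hle : ∑ k, y k ≤ ∑ j, x j generalizing x y
  · intro hxy i
    rw [abs_sub_comm, hxy]
    exact this y x hy hx (le_of_not_ge hle) hxy.symm i
  simp only [← Matrix.mulVec_mulVec]
  intro hxy i
  set X := M.mulVec x with hX
  set Y := M.mulVec y with hY
  have hX0 : 0 ≤ X := mulVec_nonneg_of_nonneg hM0 hx
  have hY0 : 0 ≤ Y := mulVec_nonneg_of_nonneg hM0 hy
  have hr : 0 ≤ X - c • Y := by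
    intro k
    simp only [Pi.zero_apply, Pi.sub_apply, Pi.smul_apply, smul_eq_mul, sub_nonneg]
    rcases (Finset.sum_nonneg fun j _ => hx j : 0 ≤ ∑ j, x j).eq_or_lt with h0 | h0
    · have hy0 : ∑ k, y k = 0 := le_antisymm (hle.trans h0.symm.le)
        (Finset.sum_nonneg fun j _ => hy j)
      have : y = 0 := (Fintype.sum_eq_zero_iff_of_nonneg hy).1 hy0
      simpa [hY, this] using hX0 k
    · refine le_of_mul_le_mul_left ?_ h0
      exact (smul_mulVec_le_of_comparable hM hx hy k).trans
        (mul_le_mul_of_nonneg_right hle (hX0 k))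
  have hs : 0 ≤ (1 - c) • Y := smul_nonneg (sub_nonneg.2 hc) hY0
  have key := h _ _ hr hs
  simp only [Matrix.mulVec_sub, Matrix.mulVec_smul, Pi.sub_apply, Pi.smul_apply, smul_eq_mul,
    Finset.sum_sub_distrib, ← Finset.mul_sum] at key
  have := key (by rw [hxy]; ring) i
  rw [← hxy] at this
  convert this using 1
  · congr 1; ring
  · ring

lemma sum_le_sum_mulVec {P : Matrix m m ℝ} (hP : ∀ j, 1 ≤ ∑ i, P i j) {x : m → ℝ}
    (hx : 0 ≤ x) : ∑ j, x j ≤ ∑ i, P.mulVec x i := by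
  simp only [Matrix.mulVec, dotProduct]
  rw [Finset.sum_comm]
  refine Finset.sum_le_sum fun j _ => ?_
  rw [← Finset.sum_mul]
  exact le_mul_of_one_le_left (hx j) (hP j)

lemma ContractionBound.dist_normalized_le {P : Matrix m m ℝ} {d : ℝ} (h : ContractionBound P d)
    (hd : 0 ≤ d) (hP : ∀ i j, 0 ≤ P i j) {x y : m → ℝ} (hx : 0 ≤ x) (hy : 0 ≤ y)
    (hPx : 0 < ∑ i, P.mulVec x i) (hPy : 0 < ∑ i, P.mulVec y i) :
    dist (fun i => P.mulVec x i / ∑ j, |P.mulVec x j|)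
      (fun i => P.mulVec y i / ∑ j, |P.mulVec y j|) ≤ d := by
  have hax : ∑ j, |P.mulVec x j| = ∑ j, P.mulVec x j :=
    Finset.sum_congr rfl fun j _ => abs_of_nonneg (mulVec_nonneg_of_nonneg hP hx j)
  have hay : ∑ j, |P.mulVec y j| = ∑ j, P.mulVec y j :=
    Finset.sum_congr rfl fun j _ => abs_of_nonneg (mulVec_nonneg_of_nonneg hP hy j)
  refine (dist_pi_le_iff hd).2 fun i => ?_
  have key := h ((∑ j, P.mulVec x j)⁻¹ • x) ((∑ j, P.mulVec y j)⁻¹ • y)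
    (smul_nonneg (inv_nonneg.2 hPx.le) hx) (smul_nonneg (inv_nonneg.2 hPy.le) hy)
  simp only [Matrix.mulVec_smul, Pi.smul_apply, smul_eq_mul, ← Finset.mul_sum,
    inv_mul_cancel₀ hPx.ne', inv_mul_cancel₀ hPy.ne', mul_one] at key
  rw [hax, hay, Real.dist_eq, div_eq_inv_mul, div_eq_inv_mul]
  exact key trivial i

end Contraction

lemma Amat_nonneg (b : Bool × Bool) (i j : Fin 4) : 0 ≤ Amat b i j := by
  rcases b with ⟨_ | _, _ | _⟩ <;> fin_cases i <;> fin_cases j <;> simp [Amat]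

lemma one_le_sum_Amat (b : Bool × Bool) (j : Fin 4) : 1 ≤ ∑ i, Amat b i j := by
  rcases b with ⟨_ | _, _ | _⟩ <;> fin_cases j <;> simp [Amat, Fin.sum_univ_four]

lemma Aprod_succ (ω : ℕ → Bool × Bool) (n : ℕ) :
    Aprod ω (n + 1) = Aprod ω n * Amat (ω n) := by
  rw [Aprod, List.ofFn_succ', List.concat_eq_append, List.prod_append, List.prod_singleton]
  rfl

lemma Aprod_nonneg (ω : ℕ → Bool × Bool) (n : ℕ) : ∀ i j, 0 ≤ Aprod ω n i j := by
  induction n with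
  | zero =>
    intro i j
    simp only [Aprod, List.ofFn_zero, List.prod_nil, Matrix.one_apply]
    split_ifs <;> norm_num
  | succ n ih =>
    intro i j
    rw [Aprod_succ, Matrix.mul_apply]
    exact Finset.sum_nonneg fun k _ => mul_nonneg (ih i k) (Amat_nonneg _ _ _)

lemma sum_le_sum_Aprod_mulVec (ω : ℕ → Bool × Bool) (n : ℕ) :
    ∀ x : Fin 4 → ℝ, 0 ≤ x → ∑ j, x j ≤ ∑ i, (Aprod ω n).mulVec x i := by
  induction n with
  | zero => intro x _; simp [Aprod]
  | succ n ih =>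
    intro x hx
    rw [Aprod_succ, ← Matrix.mulVec_mulVec]
    exact (sum_le_sum_mulVec (one_le_sum_Amat _) hx).trans
      (ih _ (mulVec_nonneg_of_nonneg (Amat_nonneg _) hx))

lemma sum_Aprod_mulVec_pos (ω : ℕ → Bool × Bool) (n : ℕ) {x : Fin 4 → ℝ} (hx : ∀ i, 0 < x i) :
    0 < ∑ i, (Aprod ω n).mulVec x i :=
  (Finset.sum_pos (fun i _ => hx i) Finset.univ_nonempty).trans_le
    (sum_le_sum_Aprod_mulVec ω n x fun i => (hx i).le)

lemma exists_Aprod_eq_mul (ω : ℕ → Bool × Bool) {n k : ℕ} (hnk : n ≤ k) :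
    ∃ Q : Matrix (Fin 4) (Fin 4) ℝ, (∀ i j, 0 ≤ Q i j) ∧ Aprod ω k = Aprod ω n * Q := by
  induction k, hnk using Nat.le_induction with
  | base =>
    refine ⟨1, fun i j => ?_, (mul_one _).symm⟩
    rw [Matrix.one_apply]
    split_ifs <;> norm_num
  | succ k _ ih =>
    obtain ⟨Q, hQ, h⟩ := ih
    refine ⟨Q * Amat (ω k), fun i j => ?_, by rw [Aprod_succ, h, mul_assoc]⟩
    rw [Matrix.mul_apply]
    exact Finset.sum_nonneg fun l _ => mul_nonneg (hQ i l) (Amat_nonneg _ _ _)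

/-- A word whose matrix product has every row either zero or strictly positive. -/
def contractingWord : Fin 3 → Bool × Bool := ![(true, false), (false, false), (true, true)]

lemma contractingWord_product :
    Amat (true, false) * Amat (false, false) * Amat (true, true) =
      !![4,2,3,3; 5,6,3,6; 0,0,0,0; 1,1,2,3] := by
  ext i j
  fin_cases i <;> fin_cases j <;>
    simp [Amat, Matrix.mul_apply, Fin.sum_univ_four] <;> norm_num

lemma contractionBound_Aprod_add_three {ω : ℕ → Bool × Bool} {n : ℕ} {d : ℝ}
    (h : ContractionBound (Aprod ω n) d) (hw : ∀ i : Fin 3, ω (n + i) = contractingWord i) :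
    ContractionBound (Aprod ω (n + 3)) (d * (1 - 1 / 3)) := by
  have h0 : ω n = (true, false) := hw 0
  have h1 : ω (n + 1) = (false, false) := hw 1
  have h2 : ω (n + 2) = (true, true) := hw 2
  have hprod : Aprod ω (n + 3) =
      Aprod ω n * (Amat (true, false) * Amat (false, false) * Amat (true, true)) := by
    rw [Aprod_succ, Aprod_succ, Aprod_succ, h0, h1, h2]
    simp only [mul_assoc]
  rw [hprod, contractingWord_product]
  refine h.mul_comparable ?_ (by norm_num) ?_
  · intro i j
    fin_cases i <;> fin_cases j <;> norm_num
  · intro i j k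
    fin_cases i <;> fin_cases j <;> fin_cases k <;> norm_num

lemma exists_contractionBound_Aprod {ω : ℕ → Bool × Bool}
    (hω : ∀ a, ∃ k ≥ a, ∀ i : Fin 3, ω (3 * k + i) = contractingWord i) (p : ℕ) :
    ∃ n, ContractionBound (Aprod ω n) ((1 - 1 / 3) ^ p) := by
  induction p with
  | zero => exact ⟨0, by simpa using contractionBound_one (Aprod_nonneg ω 0)⟩
  | succ p ih =>
    obtain ⟨n, hn⟩ := ih
    obtain ⟨k, hk, hw⟩ := hω n
    obtain ⟨Q, hQ, hprod⟩ := exists_Aprod_eq_mul ω (show n ≤ 3 * k by omega)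
    refine ⟨3 * k + 3, ?_⟩
    rw [pow_succ]
    refine contractionBound_Aprod_add_three ?_ hw
    rw [hprod]
    exact hn.mul_nonneg_right hQ

lemma exists_dist_normalized_Aprod_lt {ω : ℕ → Bool × Bool}
    (hω : ∀ a, ∃ k ≥ a, ∀ i : Fin 3, ω (3 * k + i) = contractingWord i) {ε : ℝ} (hε : 0 < ε) :
    ∃ N, ∀ n ≥ N, ∀ k ≥ N, ∀ x y : Fin 4 → ℝ, (∀ i, 0 < x i) → (∀ i, 0 < y i) →
      dist (fun i => (Aprod ω n).mulVec x i / ∑ j, |(Aprod ω n).mulVec x j|)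
        (fun i => (Aprod ω k).mulVec y i / ∑ j, |(Aprod ω k).mulVec y j|) < ε := by
  obtain ⟨p, hp⟩ := exists_pow_lt_of_lt_one hε (show (1 - 1 / 3 : ℝ) < 1 by norm_num)
  obtain ⟨N, hN⟩ := exists_contractionBound_Aprod hω p
  refine ⟨N, fun n hn k hk x y hx hy => lt_of_le_of_lt ?_ hp⟩
  have hPx := sum_Aprod_mulVec_pos ω n hx
  have hPy := sum_Aprod_mulVec_pos ω k hy
  obtain ⟨Q, hQ, hQn⟩ := exists_Aprod_eq_mul ω hn
  obtain ⟨R, hR, hRk⟩ := exists_Aprod_eq_mul ω hk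
  rw [hQn, ← Matrix.mulVec_mulVec] at hPx ⊢
  rw [hRk, ← Matrix.mulVec_mulVec] at hPy ⊢
  exact hN.dist_normalized_le (by positivity) (Aprod_nonneg ω N)
    (mulVec_nonneg_of_nonneg hQ fun i => (hx i).le)
    (mulVec_nonneg_of_nonneg hR fun i => (hy i).le) hPx hPy

lemma exists_tendsto_normalized_Aprod {ω : ℕ → Bool × Bool}
    (hω : ∀ a, ∃ k ≥ a, ∀ i : Fin 3, ω (3 * k + i) = contractingWord i) :
    ∃ u : Fin 4 → ℝ, (∀ i, 0 ≤ u i) ∧ (∑ i, u i = 1) ∧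
      ∀ x : Fin 4 → ℝ, (∀ i, 0 < x i) →
        Filter.Tendsto
          (fun n : ℕ => fun i : Fin 4 =>
            (Aprod ω n).mulVec x i / ∑ j : Fin 4, |(Aprod ω n).mulVec x j|)
          Filter.atTop (nhds u) := by
  have hone : ∀ i : Fin 4, (0 : ℝ) < (1 : Fin 4 → ℝ) i := fun _ => one_pos
  have hcauchy : CauchySeq (fun n : ℕ => fun i : Fin 4 =>
      (Aprod ω n).mulVec 1 i / ∑ j : Fin 4, |(Aprod ω n).mulVec 1 j|) := by
    refine Metric.cauchySeq_iff.2 fun ε hε => ?_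
    obtain ⟨N, hN⟩ := exists_dist_normalized_Aprod_lt hω hε
    exact ⟨N, fun n hn k hk => hN n hn k hk 1 1 hone hone⟩
  obtain ⟨u, hu⟩ := cauchySeq_tendsto_of_complete hcauchy
  have hnn : ∀ n i, 0 ≤ (Aprod ω n).mulVec 1 i := fun n i =>
    mulVec_nonneg_of_nonneg (Aprod_nonneg ω n) (fun i => (hone i).le) i
  refine ⟨u, fun i => ?_, ?_, fun x hx => ?_⟩
  · exact ge_of_tendsto' (tendsto_pi_nhds.1 hu i) fun n =>
      div_nonneg (hnn n i) (Finset.sum_nonneg fun _ _ => abs_nonneg _)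
  · refine tendsto_nhds_unique (tendsto_finsetSum _ fun i _ => tendsto_pi_nhds.1 hu i) ?_
    refine tendsto_const_nhds.congr fun n => ?_
    rw [← Finset.sum_div, Finset.sum_congr rfl fun j _ => abs_of_nonneg (hnn n j)]
    exact (div_self (sum_Aprod_mulVec_pos ω n hone).ne').symm
  · refine (tendsto_iff_of_dist (Metric.tendsto_atTop.2 fun ε hε => ?_)).1 hu
    obtain ⟨N, hN⟩ := exists_dist_normalized_Aprod_lt hω hε
    refine ⟨N, fun n hn => ?_⟩
    rw [Real.dist_0_eq_abs, abs_of_nonneg dist_nonneg]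
    exact hN n hn n hn 1 x hone hx

section Bernoulli

variable {β : Measure (ℕ → Bool × Bool)}

lemma measure_inter_word
    (hcyl : ∀ (n : ℕ) (z : Fin n → Bool × Bool),
      β {ω | ∀ i : Fin n, ω (i : ℕ) = z i} = (1 / 4 : ENNReal) ^ n)
    {N L : ℕ} {F : Set (ℕ → Bool × Bool)} (hF : DependsOn (· ∈ F) (Set.Iio N))
    (w : Fin L → Bool × Bool) :
    β (F ∩ {ω | ∀ i : Fin L, ω (N + i) = w i}) = (1 / 4) ^ L * β F := by
  classical
  set E : Set (ℕ → Bool × Bool) := {ω | ∀ i : Fin L, ω (N + i) = w i}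
  let f : (ℕ → Bool × Bool) → (Fin N → Bool × Bool) := fun ω i => ω i
  have hf : Measurable f := by fun_prop
  have hfm : ∀ z, MeasurableSet (f ⁻¹' {z}) := fun z => hf (measurableSet_singleton z)
  have hpre : f ⁻¹' ((Set.toFinite (f '' F)).toFinset : Set _) = F := by
    ext ω
    simp only [Set.Finite.coe_toFinset, Set.mem_preimage, Set.mem_image]
    refine ⟨fun ⟨ω', hω', h⟩ => ?_, fun h => ⟨ω, h, rfl⟩⟩
    have : (ω' ∈ F) = (ω ∈ F) := hF fun i hi => congrFun h ⟨i, hi⟩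
    exact this ▸ hω'
  have hcyl_f : ∀ z, β (f ⁻¹' {z}) = (1 / 4) ^ N := fun z => by
    rw [← hcyl N z]
    congr 1
    ext ω
    exact funext_iff
  have hcyl_E : ∀ z, (β.restrict E) (f ⁻¹' {z}) = (1 / 4) ^ L * β (f ⁻¹' {z}) := fun z => by
    rw [Measure.restrict_apply (hfm z), hcyl_f, ← pow_add, add_comm,
      ← hcyl (N + L) (Fin.append z w)]
    congr 1
    ext ω
    simp only [Set.mem_inter_iff, Set.mem_preimage, Set.mem_singleton_iff, funext_iff,
      Set.mem_ofPred_eq, f, E]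
    refine ⟨fun h i => ?_, fun h => ⟨fun i => ?_, fun i => ?_⟩⟩
    · refine Fin.addCases (fun i => ?_) (fun i => ?_) i
      · simpa using h.1 i
      · simpa using h.2 i
    · simpa using h (Fin.castAdd L i)
    · simpa using h (Fin.natAdd N i)
  have hFm : MeasurableSet F := hpre ▸ hf (Set.toFinite _).measurableSet
  rw [← Measure.restrict_apply hFm, ← hpre, ← sum_measure_preimage_singleton _ fun z _ => hfm z,
    ← sum_measure_preimage_singleton _ fun z _ => hfm z, Finset.mul_sum]
  exact Finset.sum_congr rfl fun z _ => hcyl_E z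

lemma measure_forall_not_word [IsProbabilityMeasure β]
    (hcyl : ∀ (n : ℕ) (z : Fin n → Bool × Bool),
      β {ω | ∀ i : Fin n, ω (i : ℕ) = z i} = (1 / 4 : ENNReal) ^ n)
    {L : ℕ} (w : Fin L → Bool × Bool) (a n : ℕ) :
    β {ω | ∀ k ∈ Set.Ico a (a + n), ¬ ∀ i : Fin L, ω (L * k + i) = w i} =
      (1 - (1 / 4) ^ L) ^ n := by
  induction n with
  | zero => simp
  | succ n ih =>
    set F := {ω : ℕ → Bool × Bool |
      ∀ k ∈ Set.Ico a (a + n), ¬ ∀ i : Fin L, ω (L * k + i) = w i} with hFdef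
    set E := {ω : ℕ → Bool × Bool | ∀ i : Fin L, ω (L * (a + n) + i) = w i} with hE
    have hF : DependsOn (· ∈ F) (Set.Iio (L * (a + n))) := by
      intro ω ω' h
      refine propext (forall₂_congr fun k hk => not_congr (forall_congr' fun i => ?_))
      have hlt : L * k + i < L * (a + n) := by
        have := Nat.mul_le_mul_left L (Nat.succ_le_of_lt hk.2)
        have := i.2
        simp only [Nat.mul_succ] at *
        omega
      rw [h _ hlt]
    have hEm : MeasurableSet E := by
      simp only [hE, Set.ofPred_forall]
      exact MeasurableSet.iInter fun i =>
        measurableSet_eq_fun (measurable_pi_apply _) measurable_const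
    have hsplit : {ω : ℕ → Bool × Bool |
        ∀ k ∈ Set.Ico a (a + (n + 1)), ¬ ∀ i : Fin L, ω (L * k + i) = w i} = F \ E := by
      ext ω
      simp only [hFdef, hE, Set.mem_sdiff, Set.mem_ofPred_eq, Set.mem_Ico]
      refine ⟨fun h => ⟨fun k hk => h k (by omega), h _ (by omega)⟩, fun h k hk => ?_⟩
      rcases (show k < a + n ∨ k = a + n by omega) with hlt | rfl
      · exact h.1 k ⟨hk.1, hlt⟩
      · exact h.2
    have hadd := measure_inter_add_sdiff (μ := β) F hEm
    rw [measure_inter_word hcyl hF w] at hadd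
    have hfin : (1 / 4 : ENNReal) ^ L * β F ≠ ⊤ := by finiteness
    rw [hsplit, pow_succ', ← ih, ENNReal.sub_mul (by finiteness), one_mul]
    exact ENNReal.eq_sub_of_add_eq' (by finiteness) (by rw [add_comm]; exact hadd)

lemma ae_frequently_word [IsProbabilityMeasure β]
    (hcyl : ∀ (n : ℕ) (z : Fin n → Bool × Bool),
      β {ω | ∀ i : Fin n, ω (i : ℕ) = z i} = (1 / 4 : ENNReal) ^ n)
    {L : ℕ} (w : Fin L → Bool × Bool) :
    ∀ᵐ ω ∂β, ∀ a, ∃ k ≥ a, ∀ i : Fin L, ω (L * k + i) = w i := by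
  refine ae_all_iff.2 fun a => ?_
  rw [ae_iff]
  have hlt : (1 - (1 / 4) ^ L : ENNReal) < 1 :=
    ENNReal.sub_lt_self ENNReal.one_ne_top one_ne_zero (by simp)
  refine le_antisymm (ge_of_tendsto' (ENNReal.tendsto_pow_atTop_nhds_zero_of_lt_one hlt)
    fun n => ?_) zero_le
  rw [← measure_forall_not_word hcyl w a n]
  refine measure_mono fun ω hω k hk h => hω ⟨k, hk.1, h⟩

end Bernoulli

/-- for the uniform `(1/4,…,1/4)` Bernoulli measure `β` on `B^ℕ`
(characterized by its values on cylinders), `β`-almost every `ω` is infinitely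
contractive: there is a probability vector `u` such that for every strictly positive
`x ∈ ℝ⁴` the `ℓ¹`-normalized vectors `A_{ω_1}⋯A_{ω_n} x / ‖A_{ω_1}⋯A_{ω_n} x‖₁`
converge to `u`. -/
theorem stmt_13 (β : Measure (ℕ → Bool × Bool)) (hβ : IsProbabilityMeasure β)
    (hcyl : ∀ (n : ℕ) (z : Fin n → Bool × Bool),
      β {ω | ∀ i : Fin n, ω (i : ℕ) = z i} = (1 / 4 : ENNReal) ^ n) :
    ∀ᵐ ω ∂β, ∃ u : Fin 4 → ℝ, (∀ i, 0 ≤ u i) ∧ (∑ i, u i = 1) ∧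
      ∀ x : Fin 4 → ℝ, (∀ i, 0 < x i) →
        Filter.Tendsto
          (fun n : ℕ => fun i : Fin 4 =>
            (Aprod ω n).mulVec x i / ∑ j : Fin 4, |(Aprod ω n).mulVec x j|)
          Filter.atTop (nhds u) := by
  filter_upwards [ae_frequently_word hcyl contractingWord] with ω hω
  exact exists_tendsto_normalized_Aprod hω
end
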